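/- Fix η ∈ ℝ with 0 ≤ η ≤ 1, let B be a nonnegative beam-splitter coefficient family for η, and let λ : ℕ → ℝ satisfy λ_k ≥ 0 for all k, λ_{k+1} ≤ λ_k for all k, and ∑_{k=0}^{∞} λ_k = 1 (tsum). Define T : ℕ → ℕ → ℝ by T n i := ∑_{k=0}^{∞} λ_k · B^{(i,k)}_n, and for a sequence r : ℕ → ℝ define (T r)_n := ∑_{i=0}^{∞} T n i · r_i. Then for every sequence r : ℕ → ℝ with nonnegative entries, r_{i+1} ≤ r_i for all i, and ∑_{i=0}^{∞} r_i = 1, the output sequence is also non-increasing: (T r)_{n+1} ≤ (T r)_n for every n ∈ ℕ. (Passive-environment bosonic channels B^↓_η are passive preserving.) -/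

import Mathlib

/-- Extension of a coefficient family to integer indices: terms with a negative
index are set to zero (they are "omitted" in the recurrence). -/
noncomputable def bsExt (B : ℕ → ℕ → ℕ → ℝ) : ℤ → ℤ → ℤ → ℝ :=
  fun i k m => if 0 ≤ i ∧ 0 ≤ k ∧ 0 ≤ m then B i.toNat k.toNat m.toNat else 0

/-- A beam-splitter coefficient family for transmittance `η`:
`B^{(i,k)}_m` are the Fock-basis transition probabilities of a beam splitter,
determined by the initial condition `B^{(0,0)}_0 = 1`, the vanishing condition
`B^{(i,k)}_m = 0` for `m > i + k`, and the recurrence relation (terms with a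
negative index being omitted). -/
structure IsBSFamily (η : ℝ) (B : ℕ → ℕ → ℕ → ℝ) : Prop where
  init : B 0 0 0 = 1
  vanish : ∀ i k m : ℕ, i + k < m → B i k m = 0
  recur : ∀ i k m : ℕ, m ≤ i + k → ¬(i = 0 ∧ k = 0 ∧ m = 0) →
    B i k m =
      η * bsExt B ((i : ℤ) - 1) (k : ℤ) ((m : ℤ) - 1)
        + (1 - η) * bsExt B ((i : ℤ) - 1) (k : ℤ) (m : ℤ)
        + η * bsExt B (i : ℤ) ((k : ℤ) - 1) (m : ℤ)
        + (1 - η) * bsExt B (i : ℤ) ((k : ℤ) - 1) ((m : ℤ) - 1)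
        - bsExt B ((i : ℤ) - 1) ((k : ℤ) - 1) ((m : ℤ) - 1)

/-- Fock-basis transition kernel `T n i = ∑'_k λ_k B^{(i,k)}_n` of the
passive-environment bosonic channel with environment eigenvalues `λ`. -/
noncomputable def peKernel (B : ℕ → ℕ → ℕ → ℝ) (lam : ℕ → ℝ) (n i : ℕ) : ℝ :=
  ∑' k : ℕ, lam k * B i k n

/-- Output Fock-basis diagonal `(T r)_n = ∑'_i T n i · r_i` of the passive-environment
bosonic channel applied to the Fock-diagonal state with diagonal `r`. -/
noncomputable def peApply (B : ℕ → ℕ → ℕ → ℝ) (lam : ℕ → ℝ) (r : ℕ → ℝ) (n : ℕ) : ℝ :=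
  ∑' i : ℕ, peKernel B lam n i * r i



noncomputable def bsC (B : ℕ → ℕ → ℕ → ℝ) (I K : ℕ) (m : ℤ) : ℝ :=
  ∑ a ∈ Finset.range I, ∑ b ∈ Finset.range K, bsExt B (a : ℤ) (b : ℤ) m

theorem bsExt_nat (B : ℕ → ℕ → ℕ → ℝ) (i k m : ℕ) :
    bsExt B (i : ℤ) (k : ℤ) (m : ℤ) = B i k m := by
  simp [bsExt]

theorem bsExt_vanish {η : ℝ} {B : ℕ → ℕ → ℕ → ℝ} (hB : IsBSFamily η B) (i k m : ℤ)
    (h : i + k < m) : bsExt B i k m = 0 := by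
  unfold bsExt
  split_ifs with h1
  · apply hB.vanish
    omega
  · rfl

theorem bsExt_negm (B : ℕ → ℕ → ℕ → ℝ) (i k m : ℤ) (h : m < 0) : bsExt B i k m = 0 := by
  unfold bsExt
  rw [if_neg]
  omega

theorem bsExt_negi (B : ℕ → ℕ → ℕ → ℝ) (i k m : ℤ) (h : i < 0) : bsExt B i k m = 0 := by
  unfold bsExt
  rw [if_neg]
  omega

theorem bsExt_negk (B : ℕ → ℕ → ℕ → ℝ) (i k m : ℤ) (h : k < 0) : bsExt B i k m = 0 := by
  unfold bsExt
  rw [if_neg]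
  omega

theorem bsExt_rec {η : ℝ} {B : ℕ → ℕ → ℕ → ℝ} (hB : IsBSFamily η B) (i k m : ℕ) :
    bsExt B (i : ℤ) (k : ℤ) (m : ℤ) =
      η * bsExt B ((i : ℤ) - 1) (k : ℤ) ((m : ℤ) - 1)
        + (1 - η) * bsExt B ((i : ℤ) - 1) (k : ℤ) (m : ℤ)
        + η * bsExt B (i : ℤ) ((k : ℤ) - 1) (m : ℤ)
        + (1 - η) * bsExt B (i : ℤ) ((k : ℤ) - 1) ((m : ℤ) - 1)
        - bsExt B ((i : ℤ) - 1) ((k : ℤ) - 1) ((m : ℤ) - 1)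
        + (if i = 0 then if k = 0 then if m = 0 then 1 else 0 else 0 else 0) := by
  by_cases h0 : i = 0 ∧ k = 0 ∧ m = 0
  · obtain ⟨rfl, rfl, rfl⟩ := h0
    rw [bsExt_nat, hB.init]
    simp [bsExt]
  · have h1 : (if i = 0 then if k = 0 then if m = 0 then (1:ℝ) else 0 else 0 else 0) = 0 := by
      split_ifs <;> simp_all
    rw [h1, add_zero]
    by_cases h : m ≤ i + k
    · rw [bsExt_nat]
      exact hB.recur i k m h h0
    · rw [bsExt_vanish hB _ _ _ (by omega), bsExt_vanish hB _ _ _ (by omega),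
        bsExt_vanish hB _ _ _ (by omega), bsExt_vanish hB _ _ _ (by omega),
        bsExt_vanish hB _ _ _ (by omega), bsExt_vanish hB _ _ _ (by omega)]
      ring

theorem sum_shift (f : ℤ → ℝ) (hf : f (-1) = 0) (I : ℕ) :
    ∑ a ∈ Finset.range (I + 1), f ((a : ℤ) - 1) = ∑ a ∈ Finset.range I, f (a : ℤ) := by
  rw [Finset.sum_range_succ']
  simp [hf]

theorem bsC_rec {η : ℝ} {B : ℕ → ℕ → ℕ → ℝ} (hB : IsBSFamily η B) (i k m : ℕ) :
    bsC B (i + 1) (k + 1) m = η * bsC B i (k + 1) ((m : ℤ) - 1)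
      + (1 - η) * bsC B i (k + 1) m + η * bsC B (i + 1) k m
      + (1 - η) * bsC B (i + 1) k ((m : ℤ) - 1) - bsC B i k ((m : ℤ) - 1)
      + (if m = 0 then 1 else 0) := by
  have e1 : ∀ (K : ℕ) (m : ℤ), bsC B i K m = ∑ a ∈ Finset.range (i + 1),
      ∑ b ∈ Finset.range K, bsExt B ((a : ℤ) - 1) (b : ℤ) m := by
    intro K m
    rw [sum_shift (fun a => ∑ b ∈ Finset.range K, bsExt B a (b : ℤ) m)]
    · rfl
    · exact Finset.sum_eq_zero fun b _ => bsExt_negi B _ _ _ (by omega)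
  have e2 : ∀ (a m : ℤ), ∑ b ∈ Finset.range k, bsExt B a (b : ℤ) m =
      ∑ b ∈ Finset.range (k + 1), bsExt B a ((b : ℤ) - 1) m := by
    intro a m
    rw [sum_shift (fun b => bsExt B a b m)]
    exact bsExt_negk B _ _ _ (by omega)
  have e3 : (if m = 0 then (1 : ℝ) else 0) = ∑ a ∈ Finset.range (i + 1),
      ∑ b ∈ Finset.range (k + 1),
        (if a = 0 then if b = 0 then if m = 0 then (1 : ℝ) else 0 else 0 else 0) := by
    rw [Finset.sum_range_succ', Finset.sum_range_succ']
    simp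
  rw [e1, e1, e1, e3]
  unfold bsC
  simp only [e2]
  simp only [Finset.mul_sum, ← Finset.sum_add_distrib, ← Finset.sum_sub_distrib]
  exact Finset.sum_congr rfl fun a _ => Finset.sum_congr rfl fun b _ => bsExt_rec hB a b m

theorem bsC_diff (B : ℕ → ℕ → ℕ → ℝ) (i k m : ℕ) :
    B i k m = bsC B (i + 1) (k + 1) m - bsC B i (k + 1) m - bsC B (i + 1) k m + bsC B i k m := by
  unfold bsC
  simp only [Finset.sum_range_succ, bsExt_nat]
  ring

theorem bsC_neg (B : ℕ → ℕ → ℕ → ℝ) (i k : ℕ) (m : ℤ) (h : m < 0) : bsC B i k m = 0 :=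
  Finset.sum_eq_zero fun _ _ => Finset.sum_eq_zero fun _ _ => bsExt_negm B _ _ _ h

theorem bsC_P {η : ℝ} {B : ℕ → ℕ → ℕ → ℝ} (hB : IsBSFamily η B) (i k m : ℕ) :
    η * bsC B i (k + 1) m + (1 - η) * bsC B (i + 1) k m - bsC B i k m
      = 1 - ∑ j ∈ Finset.range (m + 1), B i k j := by
  induction m with
  | zero =>
    have h := bsC_rec hB i k 0
    have hd := bsC_diff B i k 0
    rw [bsC_neg B i (k+1) (((0 : ℕ) : ℤ) - 1) (by simp), bsC_neg B (i+1) k (((0 : ℕ) : ℤ) - 1) (by simp),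
      bsC_neg B i k (((0 : ℕ) : ℤ) - 1) (by simp)] at h
    simp at h hd ⊢
    linarith
  | succ m ih =>
    have h := bsC_rec hB i k (m + 1)
    have hd := bsC_diff B i k (m + 1)
    rw [Finset.sum_range_succ]
    simp at h hd ih ⊢
    linarith

theorem bsC_rec0 {η : ℝ} {B : ℕ → ℕ → ℕ → ℝ} (hB : IsBSFamily η B) (i k m : ℕ) :
    bsC B (i + 1) (k + 1) m = (1 - η) * bsC B i (k + 1) m + η * bsC B (i + 1) k m
      + 1 - ∑ j ∈ Finset.range m, B i k j := by
  cases m with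
  | zero =>
    have h := bsC_rec hB i k 0
    rw [bsC_neg B i (k+1) (((0 : ℕ) : ℤ) - 1) (by simp), bsC_neg B (i+1) k (((0 : ℕ) : ℤ) - 1) (by simp),
      bsC_neg B i k (((0 : ℕ) : ℤ) - 1) (by simp)] at h
    simp at h ⊢
    linarith
  | succ m =>
    have h := bsC_rec hB i k (m + 1)
    have hd := bsC_P hB i k m
    simp at h hd ⊢
    linarith

theorem bsC_anti {η : ℝ} (hη0 : 0 ≤ η) (hη1 : η ≤ 1) {B : ℕ → ℕ → ℕ → ℝ}
    (hB : IsBSFamily η B) (hBnn : ∀ i k m, 0 ≤ B i k m) (m : ℕ) (i : ℕ) :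
    ∀ k : ℕ, bsC B i k ((m + 1 : ℕ) : ℤ) ≤ bsC B i k (m : ℤ) := by
  induction i with
  | zero => intro k; simp [bsC]
  | succ i ih =>
    intro k
    induction k with
    | zero => simp [bsC]
    | succ k ihk =>
      rw [bsC_rec0 hB, bsC_rec0 hB, Finset.sum_range_succ]
      have h1 := mul_le_mul_of_nonneg_left (ih (k + 1)) (sub_nonneg.2 hη1)
      have h2 := mul_le_mul_of_nonneg_left ihk hη0
      have h3 := hBnn i k m
      linarith

theorem bsC_nat (B : ℕ → ℕ → ℕ → ℝ) (I K m : ℕ) :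
    bsC B I K (m : ℤ) = ∑ a ∈ Finset.range I, ∑ b ∈ Finset.range K, B a b m := by
  simp only [bsC, bsExt_nat]

theorem bs_le_one {η : ℝ} (hη0 : 0 ≤ η) (hη1 : η ≤ 1) {B : ℕ → ℕ → ℕ → ℝ}
    (hB : IsBSFamily η B) (hBnn : ∀ i k m, 0 ≤ B i k m) (i k m : ℕ) : B i k m ≤ 1 := by
  have h := bsC_P hB i k m
  have h1 : bsC B i k (m : ℤ) ≤ bsC B i (k + 1) (m : ℤ) := by
    rw [bsC_nat, bsC_nat]
    refine Finset.sum_le_sum fun a _ => ?_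
    rw [Finset.sum_range_succ]
    linarith [hBnn a k m]
  have h2 : bsC B i k (m : ℤ) ≤ bsC B (i + 1) k (m : ℤ) := by
    rw [bsC_nat, bsC_nat, Finset.sum_range_succ]
    have := Finset.sum_nonneg fun b (_ : b ∈ Finset.range k) => hBnn i b m
    linarith
  have h3 := mul_le_mul_of_nonneg_left h1 hη0
  have h4 := mul_le_mul_of_nonneg_left h2 (sub_nonneg.2 hη1)
  rw [Finset.sum_range_succ] at h
  have := Finset.sum_nonneg fun j (_ : j ∈ Finset.range m) => hBnn i k j
  linarith

theorem abel_nonneg (r g : ℕ → ℝ) (hr0 : ∀ i, 0 ≤ r i) (hr : ∀ i, r (i + 1) ≤ r i)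
    (hg : ∀ N, 0 ≤ ∑ i ∈ Finset.range N, g i) (N : ℕ) :
    0 ≤ ∑ i ∈ Finset.range N, r i * g i := by
  have key : r N * ∑ i ∈ Finset.range N, g i ≤ ∑ i ∈ Finset.range N, r i * g i := by
    induction N with
    | zero => simp
    | succ N ih =>
      have h1 := mul_le_mul_of_nonneg_right (hr N) (hg (N + 1))
      rw [Finset.sum_range_succ (fun i => r i * g i)]
      rw [Finset.sum_range_succ] at h1 ⊢
      linarith
  exact le_trans (mul_nonneg (hr0 N) (hg N)) key

theorem abel_tsum (r g : ℕ → ℝ) (hr0 : ∀ i, 0 ≤ r i) (hr : ∀ i, r (i + 1) ≤ r i)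
    (hg : ∀ N, 0 ≤ ∑ i ∈ Finset.range N, g i) (hs : Summable fun i => r i * g i) :
    0 ≤ ∑' i, r i * g i :=
  ge_of_tendsto' hs.hasSum.tendsto_sum_nat (abel_nonneg r g hr0 hr hg)

/-- Passive-environment bosonic channels `B^↓_η` are passive preserving:
if the probability sequence `r` is non-increasing (passive), so is the output `T r`. -/
theorem peChannel_passive_preserving
    (η : ℝ) (hη0 : 0 ≤ η) (hη1 : η ≤ 1)
    (B : ℕ → ℕ → ℕ → ℝ) (hB : IsBSFamily η B) (hBnn : ∀ i k m, 0 ≤ B i k m)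
    (lam : ℕ → ℝ) (hlam0 : ∀ k, 0 ≤ lam k) (hlamMono : ∀ k, lam (k + 1) ≤ lam k)
    (hlamSum : ∑' k : ℕ, lam k = 1)
    (r : ℕ → ℝ) (hr0 : ∀ i, 0 ≤ r i) (hrMono : ∀ i, r (i + 1) ≤ r i)
    (hr1 : ∑' i : ℕ, r i = 1) :
    ∀ n : ℕ, peApply B lam r (n + 1) ≤ peApply B lam r n := by
  intro n
  have hls : Summable lam := by
    by_contra h
    rw [tsum_eq_zero_of_not_summable h] at hlamSum
    exact zero_ne_one hlamSum
  have hrs : Summable r := by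
    by_contra h
    rw [tsum_eq_zero_of_not_summable h] at hr1
    exact zero_ne_one hr1
  have hle := bs_le_one hη0 hη1 hB hBnn
  have hk : ∀ i m, Summable fun k => lam k * B i k m := fun i m =>
    Summable.of_nonneg_of_le (fun k => mul_nonneg (hlam0 k) (hBnn i k m))
      (fun k => mul_le_of_le_one_right (hlam0 k) (hle i k m)) hls
  have hT0 : ∀ m i, 0 ≤ peKernel B lam m i := fun m i =>
    tsum_nonneg fun k => mul_nonneg (hlam0 k) (hBnn i k m)
  have hT1 : ∀ m i, peKernel B lam m i ≤ 1 := fun m i => by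
    rw [← hlamSum]
    exact Summable.tsum_le_tsum
      (fun k => mul_le_of_le_one_right (hlam0 k) (hle i k m)) (hk i m) hls
  have hTs : ∀ m, Summable fun i => peKernel B lam m i * r i := fun m =>
    Summable.of_nonneg_of_le (fun i => mul_nonneg (hT0 m i) (hr0 i))
      (fun i => mul_le_of_le_one_left (hr0 i) (hT1 m i)) hrs
  have hpart : ∀ I, 0 ≤ ∑ i ∈ Finset.range I,
      (peKernel B lam n i - peKernel B lam (n + 1) i) := by
    intro I
    have hsub : ∀ i, peKernel B lam n i - peKernel B lam (n + 1) i
        = ∑' k, lam k * (B i k n - B i k (n + 1)) := by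
      intro i
      unfold peKernel
      rw [← (hk i n).tsum_sub (hk i (n + 1))]
      simp only [mul_sub]
    have hks : ∀ i, Summable fun k => lam k * (B i k n - B i k (n + 1)) := by
      intro i
      simp only [mul_sub]
      exact (hk i n).sub (hk i (n + 1))
    simp only [hsub]
    rw [← Summable.tsum_finsetSum (fun i _ => hks i)]
    have hss := summable_sum (s := Finset.range I) (fun i _ => hks i)
    simp only [← Finset.mul_sum] at hss ⊢
    refine abel_tsum lam _ hlam0 hlamMono ?_ hss
    intro K
    rw [Finset.sum_comm]
    simp only [Finset.sum_sub_distrib]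
    rw [← bsC_nat, ← bsC_nat, sub_nonneg]
    exact bsC_anti hη0 hη1 hB hBnn n I K
  have hd : peApply B lam r n - peApply B lam r (n + 1)
      = ∑' i, r i * (peKernel B lam n i - peKernel B lam (n + 1) i) := by
    unfold peApply
    rw [← (hTs n).tsum_sub (hTs (n + 1))]
    exact tsum_congr fun i => by ring
  have hfs : Summable fun i => r i * (peKernel B lam n i - peKernel B lam (n + 1) i) :=
    ((hTs n).sub (hTs (n + 1))).congr fun i => by ring
  rw [← sub_nonneg, hd]
  exact abel_tsum r _ hr0 hrMono hpart hfs
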